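/- Let $k>0$, let $a<b$ be real numbers, and let $U:(a,b)\to \mathrm{Mat}_{n\times n}(\mathbb{R})$ be a differentiable matrix-valued function such that $U(t)$ is symmetric for every $t\in(a,b)$ and $U$ solves the Riccati equation $U'(t)+U(t)^2+R(t)=0$ on $(a,b)$, where $R(t)$ is symmetric and $R(t)+k^2\,\mathrm{Id}$ is positive semidefinite for every $t\in(a,b)$. Fix $x\in\mathbb{R}^n$, $t_0\in(a,b)$, and $d>t_0$. If $\langle U(t_0)x,x\rangle > k\coth(k(t_0-d))\,\|x\|^2$, then for every $t\in(a,t_0]$ one has $\langle U(t)x,x\rangle > k\coth(k(t-d))\,\|x\|^2$. -/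

import Mathlib

open Matrix Set

/-- The hyperbolic cotangent. -/
noncomputable def coth (s : ℝ) : ℝ := Real.cosh s / Real.sinh s

/-- The quadratic form of an entrywise differentiable matrix curve is differentiable. -/
theorem hasDerivAt_mulVec_dotProduct {n : ℕ} {U : ℝ → Matrix (Fin n) (Fin n) ℝ}
    {A : Matrix (Fin n) (Fin n) ℝ} {t : ℝ}
    (h : ∀ i j, HasDerivAt (fun s => U s i j) (A i j) t) (x : Fin n → ℝ) :
    HasDerivAt (fun s => (U s *ᵥ x) ⬝ᵥ x) ((A *ᵥ x) ⬝ᵥ x) t := by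
  simp only [Matrix.mulVec, dotProduct]
  exact HasDerivAt.fun_sum fun i _ =>
    (HasDerivAt.fun_sum fun j _ => (h i j).mul_const (x j)).mul_const (x i)

/-- Cauchy-Schwarz turns the matrix Riccati equation into a scalar Riccati inequality. -/
theorem riccati_scalar_inequality {n : ℕ} {k : ℝ} {A B R : Matrix (Fin n) (Fin n) ℝ}
    (hA : Aᵀ = A) (hric : B + A ^ 2 + R = 0) {x : Fin n → ℝ}
    (hR : 0 ≤ ((R + (k ^ 2) • (1 : Matrix (Fin n) (Fin n) ℝ)) *ᵥ x) ⬝ᵥ x) :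
    (x ⬝ᵥ x) * ((B *ᵥ x) ⬝ᵥ x) ≤ k ^ 2 * (x ⬝ᵥ x) ^ 2 - ((A *ᵥ x) ⬝ᵥ x) ^ 2 := by
  have hcs : ((A *ᵥ x) ⬝ᵥ x) ^ 2 ≤ ((A *ᵥ x) ⬝ᵥ (A *ᵥ x)) * (x ⬝ᵥ x) := by
    simpa only [dotProduct, sq] using
      Finset.sum_mul_sq_le_sq_mul_sq Finset.univ (A *ᵥ x) x
  have hsq : ((A ^ 2) *ᵥ x) ⬝ᵥ x = (A *ᵥ x) ⬝ᵥ (A *ᵥ x) := by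
    rw [sq, ← Matrix.mulVec_mulVec, Matrix.dotProduct_mulVec, ← Matrix.mulVec_transpose, hA]
  have hsum : (B *ᵥ x) ⬝ᵥ x + ((A ^ 2) *ᵥ x) ⬝ᵥ x + (R *ᵥ x) ⬝ᵥ x = 0 := by
    rw [← add_dotProduct, ← add_dotProduct, ← Matrix.add_mulVec, ← Matrix.add_mulVec, hric,
      Matrix.zero_mulVec, zero_dotProduct]
  rw [Matrix.add_mulVec, add_dotProduct, Matrix.smul_mulVec, Matrix.one_mulVec,
    smul_dotProduct, smul_eq_mul] at hR
  have hN : 0 ≤ x ⬝ᵥ x := Finset.sum_nonneg fun i _ => mul_self_nonneg (x i)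
  have hB : (B *ᵥ x) ⬝ᵥ x ≤ k ^ 2 * (x ⬝ᵥ x) - (A *ᵥ x) ⬝ᵥ (A *ᵥ x) := by linarith
  nlinarith [mul_le_mul_of_nonneg_left hB hN]

/-- Clearing denominators in a comparison with `k coth s`. -/
theorem mul_coth_mul_lt_iff {k s N u : ℝ} (hs : s ≠ 0) :
    k * coth s * N < u ↔
      0 < u * Real.sinh s ^ 2 - k * (Real.cosh s * Real.sinh s) * N := by
  have hs' : Real.sinh s ≠ 0 := Real.sinh_ne_zero.mpr hs
  have h : u * Real.sinh s ^ 2 - k * (Real.cosh s * Real.sinh s) * N =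
      Real.sinh s ^ 2 * (u - k * coth s * N) := by
    rw [coth]; field_simp
  rw [h, mul_pos_iff_of_pos_left (by positivity), sub_pos]

/-- If a symmetric Riccati solution lies strictly above the model solution
`k coth(k(t-d))` at some time `t₀ < d`, it stays strictly above it for all earlier times. -/
theorem riccati_comparison_backward {n : ℕ} (k a b : ℝ) (hk : 0 < k) (hab : a < b)
    (U U' R : ℝ → Matrix (Fin n) (Fin n) ℝ)
    (hderiv : ∀ t ∈ Ioo a b, ∀ i j, HasDerivAt (fun s => U s i j) (U' t i j) t)
    (hUsymm : ∀ t ∈ Ioo a b, (U t)ᵀ = U t)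
    (hric : ∀ t ∈ Ioo a b, U' t + U t ^ 2 + R t = 0)
    (hRsymm : ∀ t ∈ Ioo a b, (R t)ᵀ = R t)
    (hRpsd : ∀ t ∈ Ioo a b, ∀ x : Fin n → ℝ,
      0 ≤ ((R t + (k ^ 2) • (1 : Matrix (Fin n) (Fin n) ℝ)) *ᵥ x) ⬝ᵥ x)
    (x : Fin n → ℝ) (t₀ : ℝ) (ht₀ : t₀ ∈ Ioo a b) (d : ℝ) (hd : t₀ < d)
    (hinit : k * coth (k * (t₀ - d)) * (x ⬝ᵥ x) < (U t₀ *ᵥ x) ⬝ᵥ x) :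
    ∀ t ∈ Ioc a t₀, k * coth (k * (t - d)) * (x ⬝ᵥ x) < (U t *ᵥ x) ⬝ᵥ x := by
  intro t ht
  have hN0 : 0 ≤ x ⬝ᵥ x := Finset.sum_nonneg fun i _ => mul_self_nonneg (x i)
  have hN : 0 < x ⬝ᵥ x := by
    refine hN0.lt_of_ne' fun h => ?_
    rw [dotProduct_self_eq_zero] at h
    simp [h] at hinit
  have hne : ∀ s ≤ t₀, k * (s - d) ≠ 0 := fun s hs =>
    mul_ne_zero hk.ne' (by linarith)
  rw [mul_coth_mul_lt_iff (hne _ le_rfl)] at hinit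
  rw [mul_coth_mul_lt_iff (hne _ ht.2)]
  refine hinit.trans_le ?_
  have hD : ∀ s ∈ Icc t t₀, HasDerivAt
      (fun r => ((U r *ᵥ x) ⬝ᵥ x) * Real.sinh (k * (r - d)) ^ 2 -
        k * (Real.cosh (k * (r - d)) * Real.sinh (k * (r - d))) * (x ⬝ᵥ x))
      (((U' s *ᵥ x) ⬝ᵥ x) * Real.sinh (k * (s - d)) ^ 2 +
        2 * k * ((U s *ᵥ x) ⬝ᵥ x) * Real.sinh (k * (s - d)) * Real.cosh (k * (s - d)) -
        k ^ 2 * (Real.sinh (k * (s - d)) ^ 2 + Real.cosh (k * (s - d)) ^ 2) * (x ⬝ᵥ x)) s := by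
    intro s hs
    have hs' : s ∈ Ioo a b := ⟨ht.1.trans_le hs.1, hs.2.trans_lt ht₀.2⟩
    have hl : HasDerivAt (fun r => k * (r - d)) k s := by
      simpa using ((hasDerivAt_id s).sub_const d).const_mul k
    refine (((hasDerivAt_mulVec_dotProduct (hderiv s hs') x).mul (hl.sinh.pow 2)).sub
      (((hl.cosh.mul hl.sinh).const_mul k).mul_const (x ⬝ᵥ x))).congr_deriv ?_
    simp only [Pi.pow_apply]
    ring
  refine antitoneOn_of_hasDerivWithinAt_nonpos (convex_Icc t t₀)
    (fun s hs => (hD s hs).continuousAt.continuousWithinAt)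
    (fun s hs => (hD s (interior_subset hs)).hasDerivWithinAt) (fun s hs => ?_)
    (left_mem_Icc.mpr ht.2) (right_mem_Icc.mpr ht.2) ht.2
  have hs := interior_subset hs
  have hs' : s ∈ Ioo a b := ⟨ht.1.trans_le hs.1, hs.2.trans_lt ht₀.2⟩
  have hineq := riccati_scalar_inequality (hUsymm s hs') (hric s hs') (hRpsd s hs' x)
  refine nonpos_of_mul_nonpos_right ?_ hN
  linear_combination mul_le_mul_of_nonneg_right hineq (sq_nonneg (Real.sinh (k * (s - d)))) +
    sq_nonneg (((U s *ᵥ x) ⬝ᵥ x) * Real.sinh (k * (s - d)) -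
      k * (x ⬝ᵥ x) * Real.cosh (k * (s - d)))
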